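/- Let s ≥ 1 be a real number and γ an integer with γ > d/2 + s. If f : ℝ^d → ℝ is C^γ with compact support, then the Barron norm ‖f‖_{B^s} := ∫_{ℝ^d} (1 + |ω|)^s |F[f](ω)| dω is finite; moreover there is a constant c depending only on γ and s such that ‖f‖_{B^s}^2 ≤ c ∫_{ℝ^d} (|f(x)|^2 + |D^γ f(x)|^2) dx. -/

import Mathlib

open MeasureTheory FourierTransform

section Plancherel

variable {V : Type*} [NormedAddCommGroup V] [InnerProductSpace ℝ V] [FiniteDimensional ℝ V]
  [MeasurableSpace V] [BorelSpace V]

/-- On `L¹ ∩ L²` the integral Fourier transform agrees with the `L²` Fourier transform. -/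
theorem fourier_ae_eq_fourier_toLp {g : V → ℂ} (hg : Integrable g) (hg2 : MemLp g 2) :
    𝓕 g =ᵐ[volume] (𝓕 (hg2.toLp g) : Lp (α := V) ℂ 2) := by
  have hcont : Continuous (𝓕 g) :=
    VectorFourier.fourierIntegral_continuous Real.continuous_fourierChar
      (by exact continuous_inner) hg
  refine ae_eq_of_integral_contDiff_smul_eq hcont.locallyIntegrable
    ((Lp.memLp _).locallyIntegrable one_le_two) fun φ hφ hφc => ?_
  have hψc : HasCompactSupport (fun x => (φ x : ℂ)) := hφc.comp_left (g := Complex.ofReal) rfl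
  have hψd : ContDiff ℝ (⊤ : ℕ∞) (fun x => (φ x : ℂ)) := Complex.ofRealCLM.contDiff.comp hφ
  set ψ : SchwartzMap V ℂ := hψc.toSchwartzMap hψd with hψ
  have hψx : ∀ x, ψ x = (φ x : ℂ) := fun x => rfl
  have key : ∫ x, (𝓕 ψ) x • g x = ∫ x, ψ x • 𝓕 g x := by
    have := VectorFourier.integral_fourierIntegral_smul_eq_flip (L := innerₗ V)
      (μ := volume) (ν := volume) Real.continuous_fourierChar continuous_inner
      (ψ.integrable (μ := volume)) hg
    rw [flip_innerₗ] at this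
    rw [SchwartzMap.fourier_coe]
    exact this
  have h1 := congrArg (fun T => T ψ) (Lp.fourier_toTemperedDistribution_eq (hg2.toLp g))
  simp only [TemperedDistribution.fourier_apply, Lp.toTemperedDistribution_apply] at h1
  have h2 : ∫ x, (𝓕 ψ) x • (hg2.toLp g) x = ∫ x, (𝓕 ψ) x • g x := by
    refine integral_congr_ae ?_
    filter_upwards [hg2.coeFn_toLp] with x hx
    rw [hx]
  rw [h2, key] at h1
  simpa [hψx, Complex.real_smul] using h1

theorem integral_norm_sq_eq_eLpNorm_sq {g : V → ℂ} (hg : MemLp g 2) :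
    ∫ x, ‖g x‖ ^ 2 = (eLpNorm g 2).toReal ^ 2 := by
  have h0 : 0 ≤ ∫ x, ‖g x‖ ^ 2 := integral_nonneg fun x => by positivity
  rw [hg.eLpNorm_eq_integral_rpow_norm two_ne_zero ENNReal.ofNat_ne_top]
  simp only [ENNReal.toReal_ofNat, Real.rpow_two]
  rw [ENNReal.toReal_ofReal (by positivity), ← Real.rpow_natCast, ← Real.rpow_mul h0]
  norm_num

/-- **Plancherel's theorem** for the integral Fourier transform on `L¹ ∩ L²`. -/
theorem memLp_two_fourier_and_integral_norm_sq_eq {g : V → ℂ} (hg : Integrable g)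
    (hg2 : MemLp g 2) :
    MemLp (𝓕 g) 2 ∧ ∫ ω, ‖𝓕 g ω‖ ^ 2 = ∫ x, ‖g x‖ ^ 2 := by
  have hae := fourier_ae_eq_fourier_toLp hg hg2
  have hF : MemLp (𝓕 g) 2 := (memLp_congr_ae hae).2 (Lp.memLp _)
  refine ⟨hF, ?_⟩
  rw [integral_norm_sq_eq_eLpNorm_sq hF, integral_norm_sq_eq_eLpNorm_sq hg2,
    eLpNorm_congr_ae hae, ← Lp.norm_def, Lp.norm_fourier_eq, Lp.norm_toLp]

end Plancherel

theorem sq_integral_mul_le {α : Type*} [MeasurableSpace α] {μ : Measure α} {a b : α → ℝ}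
    (ha0 : ∀ x, 0 ≤ a x) (hb0 : ∀ x, 0 ≤ b x) (ha : MemLp a 2 μ) (hb : MemLp b 2 μ) :
    (∫ x, a x * b x ∂μ) ^ 2 ≤ (∫ x, a x ^ 2 ∂μ) * ∫ x, b x ^ 2 ∂μ := by
  have h := integral_mul_le_Lp_mul_Lq_of_nonneg Real.HolderConjugate.two_two
    (Filter.Eventually.of_forall ha0) (Filter.Eventually.of_forall hb0)
    (μ := μ) (by simpa using ha) (by simpa using hb)
  simp only [Real.rpow_two, ← Real.sqrt_eq_rpow] at h
  have hA : 0 ≤ ∫ x, a x ^ 2 ∂μ := integral_nonneg fun x => by positivity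
  have hB : 0 ≤ ∫ x, b x ^ 2 ∂μ := integral_nonneg fun x => by positivity
  have h0 : 0 ≤ ∫ x, a x * b x ∂μ := integral_nonneg fun x => mul_nonneg (ha0 x) (hb0 x)
  calc _ ≤ _ := pow_le_pow_left₀ h0 h 2
    _ = _ := by rw [mul_pow, Real.sq_sqrt hA, Real.sq_sqrt hB]

theorem integrable_norm_sq_of_hasCompactSupport {V F : Type*} [TopologicalSpace V]
    [MeasurableSpace V] [OpensMeasurableSpace V] {μ : Measure V} [IsFiniteMeasureOnCompacts μ]
    [NormedAddCommGroup F] {h : V → F} (hh : Continuous h) (hc : HasCompactSupport h) :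
    Integrable (fun x => ‖h x‖ ^ 2) μ := by
  have hL : MemLp h 2 μ := hh.memLp_of_hasCompactSupport hc
  exact (memLp_two_iff_integrable_sq_norm hL.1).1 hL

/-- The norm of the Fourier transform of a pure directional derivative of order `n`. -/
theorem norm_fourier_iteratedFDeriv_apply {V : Type*} [NormedAddCommGroup V]
    [InnerProductSpace ℝ V] [FiniteDimensional ℝ V] [MeasurableSpace V] [BorelSpace V]
    {g : V → ℂ} {n : ℕ} (hg : ContDiff ℝ n g) (hgc : HasCompactSupport g) (v ω : V) :
    ‖𝓕 (fun x => iteratedFDeriv ℝ n g x (fun _ => v)) ω‖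
      = (2 * Real.pi) ^ n * |inner ℝ ω v| ^ n * ‖𝓕 g ω‖ := by
  have hint : ∀ k : ℕ, (k : ℕ∞) ≤ (n : ℕ∞) → Integrable (iteratedFDeriv ℝ k g) := fun k hk =>
    (hg.continuous_iteratedFDeriv (by exact_mod_cast hk)).integrable_of_hasCompactSupport
      (hgc.iteratedFDeriv k)
  rw [← Real.fourier_continuousMultilinearMap_apply (hint n le_rfl),
    Real.fourier_iteratedFDeriv (N := n) (by exact_mod_cast hg) hint le_rfl]
  simp [VectorFourier.fourierPowSMulRight_apply, abs_of_pos Real.pi_pos, mul_assoc]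
  exact Or.inl rfl

theorem integrable_inner_pow_mul_fourier_sq_and_integral_sq_le {V : Type*} [NormedAddCommGroup V]
    [InnerProductSpace ℝ V] [FiniteDimensional ℝ V] [MeasurableSpace V] [BorelSpace V]
    {g : V → ℂ} {n : ℕ} (hg : ContDiff ℝ n g) (hgc : HasCompactSupport g) {v : V} (hv : ‖v‖ = 1) :
    Integrable (fun ω => (|inner ℝ ω v| ^ n * ‖𝓕 g ω‖) ^ 2) ∧
    ∫ ω, (|inner ℝ ω v| ^ n * ‖𝓕 g ω‖) ^ 2 ≤ ∫ x, ‖iteratedFDeriv ℝ n g x‖ ^ 2 := by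
  have hcD := hg.continuous_iteratedFDeriv le_rfl
  have hcont : Continuous (fun x => iteratedFDeriv ℝ n g x (fun _ => v)) :=
    (ContinuousMultilinearMap.apply ℝ (fun _ : Fin n => V) ℂ (fun _ => v)).continuous.comp hcD
  have hcs : HasCompactSupport (fun x => iteratedFDeriv ℝ n g x (fun _ => v)) :=
    (hgc.iteratedFDeriv (𝕜 := ℝ) n).comp_left
      (g := fun T : ContinuousMultilinearMap ℝ (fun _ : Fin n => V) ℂ => T (fun _ => v)) rfl
  obtain ⟨hF, hFeq⟩ := memLp_two_fourier_and_integral_norm_sq_eq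
    (hcont.integrable_of_hasCompactSupport hcs) (hcont.memLp_of_hasCompactSupport hcs)
  have hI := (memLp_two_iff_integrable_sq_norm hF.1).1 hF
  have hle : ∀ ω, (|inner ℝ ω v| ^ n * ‖𝓕 g ω‖) ^ 2 ≤
      ‖𝓕 (fun x => iteratedFDeriv ℝ n g x (fun _ => v)) ω‖ ^ 2 := fun ω => by
    rw [norm_fourier_iteratedFDeriv_apply hg hgc]
    have h1 : (1 : ℝ) ≤ (2 * Real.pi) ^ n := one_le_pow₀ (by linarith [Real.pi_gt_three])
    gcongr
    exact le_mul_of_one_le_left (by positivity) h1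
  have hcF : Continuous (𝓕 g) :=
    VectorFourier.fourierIntegral_continuous Real.continuous_fourierChar
      (by exact continuous_inner) (hg.continuous.integrable_of_hasCompactSupport hgc)
  have hID : Integrable (fun x => ‖iteratedFDeriv ℝ n g x‖ ^ 2) :=
    integrable_norm_sq_of_hasCompactSupport hcD (hgc.iteratedFDeriv n)
  constructor
  · refine hI.mono' (Continuous.aestronglyMeasurable (by fun_prop))
      (Filter.Eventually.of_forall fun ω => ?_)
    rw [Real.norm_of_nonneg (by positivity)]
    exact hle ω
  · refine (integral_mono_of_nonneg (Filter.Eventually.of_forall fun ω => by positivity) hI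
      (Filter.Eventually.of_forall hle)).trans (hFeq.le.trans ?_)
    refine integral_mono_of_nonneg (Filter.Eventually.of_forall fun x => by positivity) hID
      (Filter.Eventually.of_forall fun x => ?_)
    have := (iteratedFDeriv ℝ n g x).le_opNorm (fun _ => v)
    simp only [hv, Finset.prod_const_one, mul_one] at this
    exact pow_le_pow_left₀ (norm_nonneg _) this 2

theorem one_add_norm_pow_le {d : ℕ} (m : ℕ) (ω : EuclideanSpace ℝ (Fin d)) :
    (1 + ‖ω‖) ^ (2 * (m + 1)) ≤
      2 ^ (2 * (m + 1)) * (1 + (d : ℝ) ^ m * ∑ i, (ω i ^ 2) ^ (m + 1)) := by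
  have h : (‖ω‖ ^ 2) ^ (m + 1) ≤ (d : ℝ) ^ m * ∑ i, (ω i ^ 2) ^ (m + 1) := by
    rw [EuclideanSpace.real_norm_sq_eq]
    simpa using pow_sum_le_card_mul_sum_pow (s := Finset.univ) (f := fun i => ω i ^ 2)
      (fun i _ => sq_nonneg _) m
  calc (1 + ‖ω‖) ^ (2 * (m + 1))
      ≤ 2 ^ (2 * (m + 1) - 1) * (1 ^ (2 * (m + 1)) + ‖ω‖ ^ (2 * (m + 1))) :=
        add_pow_le zero_le_one (norm_nonneg _) _
    _ ≤ 2 ^ (2 * (m + 1)) * (1 ^ (2 * (m + 1)) + ‖ω‖ ^ (2 * (m + 1))) := by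
        gcongr
        · norm_num
        · omega
    _ = 2 ^ (2 * (m + 1)) * (1 + (‖ω‖ ^ 2) ^ (m + 1)) := by rw [one_pow, pow_mul ‖ω‖]
    _ ≤ _ := by gcongr

/-- The `L²` norm of `(1 + |ω|) ^ n |F[g](ω)|` is controlled by `g` and its `n`-th derivative. -/
theorem weighted_fourier_sq_le {d n : ℕ} (hn : n ≠ 0) {g : EuclideanSpace ℝ (Fin d) → ℂ}
    (hg : ContDiff ℝ n g) (hgc : HasCompactSupport g) :
    MemLp (fun ω => (1 + ‖ω‖) ^ n * ‖𝓕 g ω‖) 2 ∧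
    ∫ ω, ((1 + ‖ω‖) ^ n * ‖𝓕 g ω‖) ^ 2 ≤ 2 ^ (2 * n) * (1 + (d : ℝ) ^ n) *
      ((∫ x, ‖g x‖ ^ 2) + ∫ x, ‖iteratedFDeriv ℝ n g x‖ ^ 2) := by
  obtain ⟨m, hnm⟩ : ∃ m, n = m + 1 := Nat.exists_eq_succ_of_ne_zero hn
  obtain ⟨hF2, hFeq⟩ := memLp_two_fourier_and_integral_norm_sq_eq
    (hg.continuous.integrable_of_hasCompactSupport hgc)
    (hg.continuous.memLp_of_hasCompactSupport hgc)
  have hD : ∀ i, Integrable (fun ω : EuclideanSpace ℝ (Fin d) => (|ω i| ^ n * ‖𝓕 g ω‖) ^ 2) ∧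
      ∫ ω : EuclideanSpace ℝ (Fin d), (|ω i| ^ n * ‖𝓕 g ω‖) ^ 2 ≤
        ∫ x, ‖iteratedFDeriv ℝ n g x‖ ^ 2 := fun i => by
    have := integrable_inner_pow_mul_fourier_sq_and_integral_sq_le hg hgc
      (v := EuclideanSpace.single i 1) (by simp)
    simpa only [EuclideanSpace.inner_single_right, one_mul, conj_trivial] using this
  have hpt : ∀ ω : EuclideanSpace ℝ (Fin d), ((1 + ‖ω‖) ^ n * ‖𝓕 g ω‖) ^ 2 ≤
      2 ^ (2 * n) * (‖𝓕 g ω‖ ^ 2 + (d : ℝ) ^ m * ∑ i, (|ω i| ^ n * ‖𝓕 g ω‖) ^ 2) := fun ω => by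
    have h : ∀ i, (|ω i| ^ n * ‖𝓕 g ω‖) ^ 2 = (ω i ^ 2) ^ n * ‖𝓕 g ω‖ ^ 2 := fun i => by
      rw [← sq_abs (ω i)]; ring
    calc ((1 + ‖ω‖) ^ n * ‖𝓕 g ω‖) ^ 2 = (1 + ‖ω‖) ^ (2 * n) * ‖𝓕 g ω‖ ^ 2 := by ring
      _ ≤ 2 ^ (2 * n) * (1 + (d : ℝ) ^ m * ∑ i, (ω i ^ 2) ^ n) * ‖𝓕 g ω‖ ^ 2 := by
          rw [hnm]
          gcongr
          exact one_add_norm_pow_le m ω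
      _ = _ := by
          simp_rw [h]
          rw [← Finset.sum_mul]; ring
  have hcontF : Continuous (𝓕 g) :=
    VectorFourier.fourierIntegral_continuous Real.continuous_fourierChar
      (by exact continuous_inner) (hg.continuous.integrable_of_hasCompactSupport hgc)
  have hcont : Continuous (fun ω => (1 + ‖ω‖) ^ n * ‖𝓕 g ω‖) := by fun_prop
  have hIF : Integrable (fun ω => ‖𝓕 g ω‖ ^ 2) := (memLp_two_iff_integrable_sq_norm hF2.1).1 hF2
  have hIsum : Integrable (fun ω : EuclideanSpace ℝ (Fin d) =>
      (d : ℝ) ^ m * ∑ i, (|ω i| ^ n * ‖𝓕 g ω‖) ^ 2) :=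
    (integrable_finsetSum _ fun i _ => (hD i).1).const_mul _
  have hIR : Integrable (fun ω : EuclideanSpace ℝ (Fin d) =>
      2 ^ (2 * n) * (‖𝓕 g ω‖ ^ 2 + (d : ℝ) ^ m * ∑ i, (|ω i| ^ n * ‖𝓕 g ω‖) ^ 2)) :=
    (hIF.add hIsum).const_mul _
  refine ⟨(memLp_two_iff_integrable_sq hcont.aestronglyMeasurable).2
    (hIR.mono' (hcont.pow 2).aestronglyMeasurable (Filter.Eventually.of_forall fun ω => ?_)), ?_⟩
  · rw [Real.norm_of_nonneg (by positivity)]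
    exact hpt ω
  refine (integral_mono_of_nonneg (Filter.Eventually.of_forall fun ω => by positivity) hIR
    (Filter.Eventually.of_forall hpt)).trans ?_
  rw [integral_const_mul, integral_add hIF hIsum, integral_const_mul,
    integral_finsetSum _ fun i _ => (hD i).1, hFeq, mul_assoc]
  have hA : 0 ≤ ∫ x, ‖g x‖ ^ 2 := integral_nonneg fun x => by positivity
  have hB : 0 ≤ ∫ x, ‖iteratedFDeriv ℝ n g x‖ ^ 2 := integral_nonneg fun x => by positivity
  have hS : ∑ i, ∫ ω : EuclideanSpace ℝ (Fin d), (|ω i| ^ n * ‖𝓕 g ω‖) ^ 2 ≤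
      d * ∫ x, ‖iteratedFDeriv ℝ n g x‖ ^ 2 := by
    simpa using Finset.sum_le_sum fun i (_ : i ∈ Finset.univ) => (hD i).2
  refine mul_le_mul_of_nonneg_left ?_ (by positivity)
  have hdS := mul_le_mul_of_nonneg_left hS (by positivity : (0 : ℝ) ≤ (d : ℝ) ^ m)
  have hdn : (d : ℝ) ^ n = d ^ m * d := by rw [hnm, pow_succ]
  have hdA := mul_nonneg (by positivity : (0 : ℝ) ≤ (d : ℝ) ^ m * d) hA
  rw [hdn]
  linarith

theorem weighted_fourier_ofReal_sq_le {d n : ℕ} (hn : n ≠ 0) {f : EuclideanSpace ℝ (Fin d) → ℝ}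
    (hf : ContDiff ℝ n f) (hfc : HasCompactSupport f) :
    MemLp (fun ω => (1 + ‖ω‖) ^ n * ‖𝓕 (fun x => (f x : ℂ)) ω‖) 2 ∧
    ∫ ω, ((1 + ‖ω‖) ^ n * ‖𝓕 (fun x => (f x : ℂ)) ω‖) ^ 2 ≤
      2 ^ (2 * n) * (1 + (d : ℝ) ^ n) * ∫ x, (|f x| ^ 2 + ‖iteratedFDeriv ℝ n f x‖ ^ 2) := by
  have hg : ContDiff ℝ n (fun x => (f x : ℂ)) := Complex.ofRealCLM.contDiff.comp hf
  have hgc : HasCompactSupport (fun x => (f x : ℂ)) :=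
    hfc.comp_left (g := Complex.ofReal) rfl
  have hnorm : ∀ x, ‖iteratedFDeriv ℝ n (fun x => (f x : ℂ)) x‖ = ‖iteratedFDeriv ℝ n f x‖ :=
    fun x => Complex.ofRealLI.norm_iteratedFDeriv_comp_left hf.contDiffAt le_rfl
  have hIf : Integrable (fun x => |f x| ^ 2) :=
    integrable_norm_sq_of_hasCompactSupport hf.continuous hfc
  have hID : Integrable (fun x => ‖iteratedFDeriv ℝ n f x‖ ^ 2) :=
    integrable_norm_sq_of_hasCompactSupport (hf.continuous_iteratedFDeriv le_rfl)
      (hfc.iteratedFDeriv n)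
  have h := weighted_fourier_sq_le hn hg hgc
  simp only [hnorm, Complex.norm_real, Real.norm_eq_abs] at h
  rwa [integral_add hIf hID]

theorem stmt8 (s : ℝ) (hs : 1 ≤ s) (γ : ℕ) :
    ∃ c : ℝ, 0 < c ∧
      ∀ (d : ℕ) (f : EuclideanSpace ℝ (Fin d) → ℝ),
        (d : ℝ) / 2 + s < γ → ContDiff ℝ γ f → HasCompactSupport f →
        Integrable (fun ω : EuclideanSpace ℝ (Fin d) =>
            (1 + ‖ω‖) ^ s * ‖𝓕 (fun x => (f x : ℂ)) ω‖) ∧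
        (∫ ω : EuclideanSpace ℝ (Fin d), (1 + ‖ω‖) ^ s * ‖𝓕 (fun x => (f x : ℂ)) ω‖) ^ 2 ≤
          c * ∫ x : EuclideanSpace ℝ (Fin d), (|f x| ^ 2 + ‖iteratedFDeriv ℝ γ f x‖ ^ 2) := by
  set A : ℕ → ℝ := fun d =>
    (∫ ω : EuclideanSpace ℝ (Fin d), ((1 + ‖ω‖) ^ (s - γ)) ^ 2) *
      (2 ^ (2 * γ) * (1 + (d : ℝ) ^ γ)) with hA
  have hA0 : ∀ d, 0 ≤ A d := fun d =>
    mul_nonneg (integral_nonneg fun ω => by positivity) (by positivity)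
  refine ⟨1 + ∑ d ∈ Finset.range (2 * γ), A d,
    add_pos_of_pos_of_nonneg one_pos (Finset.sum_nonneg fun d _ => hA0 d), ?_⟩
  intro d f hd hf hfc
  have hγ : γ ≠ 0 := by
    rintro rfl
    have : (0 : ℝ) ≤ d := Nat.cast_nonneg d
    norm_num at hd
    linarith
  have hdγ : d ∈ Finset.range (2 * γ) := by
    rw [Finset.mem_range]
    have : (d : ℝ) < 2 * γ := by linarith
    exact_mod_cast this
  obtain ⟨hb, hble⟩ := weighted_fourier_ofReal_sq_le hγ hf hfc
  have hpos : ∀ ω : EuclideanSpace ℝ (Fin d), 0 < 1 + ‖ω‖ := fun ω => by positivity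
  have hacont : Continuous (fun ω : EuclideanSpace ℝ (Fin d) => (1 + ‖ω‖) ^ (s - γ)) :=
    (by fun_prop : Continuous fun ω : EuclideanSpace ℝ (Fin d) => 1 + ‖ω‖).rpow_const
      fun ω => Or.inl (hpos ω).ne'
  have ha : MemLp (fun ω : EuclideanSpace ℝ (Fin d) => (1 + ‖ω‖) ^ (s - γ)) 2 := by
    rw [memLp_two_iff_integrable_sq hacont.aestronglyMeasurable]
    have := integrable_one_add_norm (E := EuclideanSpace ℝ (Fin d)) (μ := volume)
      (r := 2 * (γ - s)) (by rw [finrank_euclideanSpace_fin]; linarith)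
    refine this.congr (Filter.Eventually.of_forall fun ω => ?_)
    simp only
    rw [← Real.rpow_natCast, ← Real.rpow_mul (hpos ω).le]
    congr 1
    push_cast
    ring
  have hab : ∀ ω : EuclideanSpace ℝ (Fin d), (1 + ‖ω‖) ^ s * ‖𝓕 (fun x => (f x : ℂ)) ω‖ =
      (1 + ‖ω‖) ^ (s - γ) * ((1 + ‖ω‖) ^ γ * ‖𝓕 (fun x => (f x : ℂ)) ω‖) := fun ω => by
    rw [← mul_assoc, ← Real.rpow_natCast (1 + ‖ω‖) γ, ← Real.rpow_add (hpos ω), sub_add_cancel]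
  simp_rw [hab]
  refine ⟨ha.integrable_mul hb, ?_⟩
  have hR : 0 ≤ ∫ x, (|f x| ^ 2 + ‖iteratedFDeriv ℝ γ f x‖ ^ 2) :=
    integral_nonneg fun x => by positivity
  calc _ ≤ _ := sq_integral_mul_le (fun ω => by positivity) (fun ω => by positivity) ha hb
    _ ≤ _ := mul_le_mul_of_nonneg_left hble (integral_nonneg fun ω => by positivity)
    _ = A d * ∫ x, (|f x| ^ 2 + ‖iteratedFDeriv ℝ γ f x‖ ^ 2) := (mul_assoc _ _ _).symm
    _ ≤ _ := by
      gcongr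
      have := Finset.single_le_sum (fun i _ => hA0 i) hdγ
      linarith
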